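/- Let I₀ : C([0,T],ℝ) → [0,∞] be defined by I₀(f) = (1/2)∫₀ᵀ (f'(t))² dt if f is absolutely continuous on [0,T], and I₀(f) = ∞ otherwise. Then I₀ is lower semicontinuous with respect to the uniform (sup) metric on C([0,T],ℝ). -/

import Mathlib

open MeasureTheory Set
open scoped ENNReal

/-- `f : C([0,T],ℝ)` is absolutely continuous with a.e. derivative `g` if it is the
integral of the integrable function `g`. -/
def ACRepr (T : ℝ) (f : C(Icc (0:ℝ) T, ℝ)) (g : ℝ → ℝ) : Prop :=
  IntervalIntegrable g volume 0 T ∧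
    ∀ t : Icc (0:ℝ) T, f t = f ⟨0, Set.left_mem_Icc.mpr (t.2.1.trans t.2.2)⟩
      + ∫ s in (0:ℝ)..(t : ℝ), g s
theorem aux_half_sq (a : ℝ≥0∞) (r : NNReal) :
    (1/2) * a^2 ≤ (r : ℝ≥0∞) ↔ a ≤ (NNReal.sqrt (2 * r) : ℝ≥0∞) := by
  induction a with
  | top => simp [ENNReal.mul_top]
  | coe x =>
    have : ((1/2 : ℝ≥0∞)) = ((1/2 : NNReal) : ℝ≥0∞) := by simp
    rw [this]
    norm_cast
    rw [NNReal.le_sqrt_iff_sq_le, ← NNReal.coe_le_coe, ← NNReal.coe_le_coe]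
    push_cast
    constructor <;> intro h <;> linarith

theorem aux_lintegral_sq (μ : Measure ℝ) (g : ℝ → ℝ) :
    ∫⁻ t, ENNReal.ofReal ((g t)^2) ∂μ = (eLpNorm g 2 μ)^2 := by
  rw [eLpNorm_eq_lintegral_rpow_enorm_toReal (by simp) (by simp), ← ENNReal.rpow_natCast,
    ← ENNReal.rpow_mul]
  simp only [ENNReal.toReal_ofNat]
  norm_num
  refine lintegral_congr fun t => ?_
  rw [← sq_abs, ENNReal.ofReal_pow (abs_nonneg _), Real.enorm_eq_ofReal_abs]

/-- Functions whose increments are represented by a functional in a ball of the dual of `L²`. -/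
def auxSet (T : ℝ) (hT : 0 < T) (R : ℝ) : Set (C(Icc (0:ℝ) T, ℝ)) :=
  {f | ∃ φ ∈ (WeakDual.toStrongDual ⁻¹' Metric.closedBall 0 R :
      Set (WeakDual ℝ (Lp ℝ 2 (volume.restrict (Ioc (0:ℝ) T))))),
    ∀ t : Icc (0:ℝ) T, f t = f ⟨0, left_mem_Icc.mpr hT.le⟩ +
      φ (indicatorConstLp 2 (measurableSet_Ioc (a := 0) (b := (t:ℝ)))
        (measure_ne_top _ _) (1:ℝ))}

theorem auxSet_isClosed (T : ℝ) (hT : 0 < T) (R : ℝ) : IsClosed (auxSet T hT R) := by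
  set K := (WeakDual.toStrongDual ⁻¹' Metric.closedBall 0 R :
      Set (WeakDual ℝ (Lp ℝ 2 (volume.restrict (Ioc (0:ℝ) T))))) with hK
  have hKc : IsCompact K := WeakDual.isCompact_closedBall _ _
  have : CompactSpace K := isCompact_iff_compactSpace.mp hKc
  have hS : IsClosed {p : C(Icc (0:ℝ) T, ℝ) × K |
      ∀ t : Icc (0:ℝ) T, p.1 t = p.1 ⟨0, left_mem_Icc.mpr hT.le⟩ +
      p.2.1 (indicatorConstLp 2 (measurableSet_Ioc (a := 0) (b := (t:ℝ)))
        (measure_ne_top _ _) (1:ℝ))} := by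
    rw [Set.ofPred_forall]
    refine isClosed_iInter fun t => isClosed_eq ?_ (Continuous.add ?_ ?_)
    · exact (continuous_eval_const t).comp continuous_fst
    · exact (continuous_eval_const _).comp continuous_fst
    · exact (WeakDual.eval_continuous _).comp (continuous_subtype_val.comp continuous_snd)
  have := isClosedMap_fst_of_compactSpace _ hS
  convert this using 1
  ext f
  constructor
  · rintro ⟨φ, h1, h2⟩
    exact ⟨(f, ⟨φ, h1⟩), h2, rfl⟩
  · rintro ⟨⟨f', φ⟩, h, rfl⟩
    exact ⟨φ.1, φ.2, h⟩

theorem aux_pair (T : ℝ) (t : Icc (0:ℝ) T)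
    (u : Lp ℝ 2 (volume.restrict (Ioc (0:ℝ) T))) :
    InnerProductSpace.toDual ℝ _ u
      (indicatorConstLp 2 (measurableSet_Ioc (a := 0) (b := (t:ℝ)))
        (measure_ne_top _ _) (1:ℝ)) = ∫ s in (0:ℝ)..(t:ℝ), u s := by
  rw [InnerProductSpace.toDual_apply_apply, real_inner_comm, L2.inner_indicatorConstLp_one,
    intervalIntegral.integral_of_le t.2.1, Measure.restrict_restrict measurableSet_Ioc,
    inter_eq_left.mpr (Ioc_subset_Ioc_right t.2.2)]

theorem mem_auxSet_of (T : ℝ) (hT : 0 < T) (f : C(Icc (0:ℝ) T, ℝ)) (g : ℝ → ℝ)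
    (hg : ACRepr T f g) (r : NNReal)
    (h : (1/2) * ∫⁻ t in Icc (0:ℝ) T, ENNReal.ofReal ((g t)^2) ≤ r) :
    f ∈ auxSet T hT (NNReal.sqrt (2 * r)) := by
  rw [← restrict_Ioc_eq_restrict_Icc, aux_lintegral_sq, aux_half_sq] at h
  have hm : MemLp g 2 (volume.restrict (Ioc (0:ℝ) T)) :=
    ⟨((intervalIntegrable_iff_integrableOn_Ioc_of_le hT.le).1 hg.1).aestronglyMeasurable,
      h.trans_lt ENNReal.coe_lt_top⟩
  refine ⟨StrongDual.toWeakDual (InnerProductSpace.toDual ℝ _ hm.toLp), ?_, fun t => ?_⟩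
  · change InnerProductSpace.toDual ℝ _ hm.toLp ∈ Metric.closedBall 0 _
    rw [mem_closedBall_zero_iff, LinearIsometryEquiv.norm_map, Lp.norm_toLp]
    exact ENNReal.toReal_le_coe_of_le_coe h
  · have h1 := aux_pair T t hm.toLp
    have h2 : ∫ s in (0:ℝ)..(t:ℝ), hm.toLp g s = ∫ s in (0:ℝ)..(t:ℝ), g s := by
      rw [intervalIntegral.integral_of_le t.2.1, intervalIntegral.integral_of_le t.2.1]
      exact integral_congr_ae
        (ae_restrict_of_ae_restrict_of_subset (Ioc_subset_Ioc_right t.2.2) hm.coeFn_toLp)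
    rw [hg.2 t, ← h2, ← h1]
    rfl

theorem of_mem_auxSet (T : ℝ) (hT : 0 < T) (f : C(Icc (0:ℝ) T, ℝ)) (r : NNReal)
    (h : f ∈ auxSet T hT (NNReal.sqrt (2 * r))) :
    ∃ g, ACRepr T f g ∧
      (1/2) * ∫⁻ t in Icc (0:ℝ) T, ENNReal.ofReal ((g t)^2) ≤ r := by
  obtain ⟨φ, h1, h2⟩ := h
  obtain ⟨u, hu⟩ := (InnerProductSpace.toDual ℝ
    (Lp ℝ 2 (volume.restrict (Ioc (0:ℝ) T)))).surjective (WeakDual.toStrongDual φ)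
  refine ⟨u, ⟨?_, fun t => ?_⟩, ?_⟩
  · rw [intervalIntegrable_iff_integrableOn_Ioc_of_le hT.le]
    exact (Lp.memLp u).integrable (by norm_num)
  · rw [← aux_pair T t u, hu, h2 t]
    rfl
  · rw [← restrict_Ioc_eq_restrict_Icc, aux_lintegral_sq, aux_half_sq]
    rw [mem_preimage, ← hu, mem_closedBall_zero_iff, LinearIsometryEquiv.norm_map,
      Lp.norm_def] at h1
    exact (ENNReal.toReal_le_toReal (Lp.eLpNorm_ne_top u) ENNReal.coe_ne_top).1 h1

/-- The rate functional `I₀(f) = (1/2)∫₀ᵀ (f'(t))² dt` (`= ∞` if `f` is not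
absolutely continuous) is lower semicontinuous on `C([0,T],ℝ)` with the sup metric. -/
theorem I0_lowerSemicontinuous (T : ℝ) (hT : 0 < T) :
    LowerSemicontinuous (fun f : C(Icc (0:ℝ) T, ℝ) =>
      sInf {E : ℝ≥0∞ | ∃ g : ℝ → ℝ, ACRepr T f g ∧
        E = (1/2) * ∫⁻ t in Icc (0:ℝ) T, ENNReal.ofReal ((g t)^2)}) := by
  intro f y hy
  obtain ⟨r, hyr, hr⟩ := ENNReal.lt_iff_exists_nnreal_btwn.1 hy
  have hf : f ∉ auxSet T hT (NNReal.sqrt (2 * r)) := by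
    intro hf
    obtain ⟨g, hg, hle⟩ := of_mem_auxSet T hT f r hf
    exact absurd (hr.trans_le (sInf_le ⟨g, hg, rfl⟩)) (not_lt.2 hle)
  filter_upwards [(auxSet_isClosed T hT _).isOpen_compl.mem_nhds hf] with f' hf'
  refine hyr.trans_le (le_sInf ?_)
  rintro E ⟨g, hg, rfl⟩
  by_contra hlt
  exact hf' (mem_auxSet_of T hT f' g hg r (not_le.1 hlt).le)
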